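/- arXiv:2404.00324 — 2 statements merged into one kernel-verified Lean document; each statement's English description precedes it below -/
import Mathlib

section
/- Every n-vertex ℤ/3-flow-critical graph F other than K₂ and K₄ satisfies |E(F)| ≥ (5/3)n. -/
open Finset

/-- A multigraph with a fixed orientation of its edges: each edge has a
tail and a head. -/
structure MultiGraph where
  V : Type
  E : Type
  [fV : Fintype V]
  [fE : Fintype E]
  [dV : DecidableEq V]
  [dE : DecidableEq E]
  tail : E → V
  head : E → V

namespace MultiGraph

attribute [instance] fV fE dV dE

variable (G : MultiGraph)

/-- The incidence sign `[v,e]`: `1` if `e` is oriented towards `v`, `-1` if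
oriented away from `v`, `0` otherwise (so `0` on loops). -/
def sign (v : G.V) (e : G.E) : ℤ :=
  (if G.head e = v then 1 else 0) - (if G.tail e = v then 1 else 0)

/-- A flow with values in an abelian group: conservation at every vertex. -/
def IsFlow {A : Type*} [AddCommGroup A] (φ : G.E → A) : Prop :=
  ∀ v : G.V, ∑ e : G.E, G.sign v e • φ e = 0

/-- A nowhere-zero flow. -/
def IsNZFlow {A : Type*} [AddCommGroup A] (φ : G.E → A) : Prop :=
  G.IsFlow φ ∧ ∀ e : G.E, φ e ≠ 0

/-- `G` admits a nowhere-zero `A`-flow. -/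
def HasNZFlow (A : Type*) [AddCommGroup A] : Prop :=
  ∃ φ : G.E → A, G.IsNZFlow φ

/-- Two vertices are joined by an edge (in either direction). -/
def Adj (a b : G.V) : Prop :=
  ∃ e : G.E, (G.tail e = a ∧ G.head e = b) ∨ (G.tail e = b ∧ G.head e = a)

/-- `G` is connected. -/
def Connected : Prop :=
  Nonempty G.V ∧ ∀ a b : G.V, Relation.ReflTransGen G.Adj a b

/-- Contraction of a set of edges: the contracted edges are removed and
their endpoints identified. -/
noncomputable def contract (S : Set G.E) : MultiGraph := by
  classical
  exact
  { V := Quot (fun a b : G.V => ∃ e ∈ S, G.tail e = a ∧ G.head e = b)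
    E := {e : G.E // e ∉ S}
    fV := Fintype.ofSurjective (Quot.mk _) (Quot.mk_surjective)
    tail := fun e => Quot.mk _ (G.tail e.1)
    head := fun e => Quot.mk _ (G.head e.1) }

/-- `G` is `A`-flow-critical: `G` is connected, has no nowhere-zero `A`-flow,
but every single-edge contraction does. -/
noncomputable def FlowCritical (A : Type*) [AddCommGroup A] : Prop :=
  G.Connected ∧ ¬ G.HasNZFlow A ∧ ∀ e : G.E, (G.contract {e}).HasNZFlow A

/-- The degree of a vertex (loops counted twice). -/
def degree (v : G.V) : ℕ :=
  (univ.filter fun e : G.E => G.tail e = v).card +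
    (univ.filter fun e : G.E => G.head e = v).card

/-- Incidence of a vertex and an edge. -/
def Incident (v : G.V) (e : G.E) : Prop := G.tail e = v ∨ G.head e = v

/-- The vector `δ_v ∈ (ℤ/3)^{E(G)}`, `δ_v(e) = [v,e]`. -/
def deltaV (v : G.V) : G.E → ZMod 3 := fun e => (G.sign v e : ZMod 3)

/-- The vector `δ_{v,e₁,e₂}`: `[v,e₁]` on `e₁`, `-[v,e₂]` on `e₂`, `0` elsewhere. -/
def deltaPair (v : G.V) (e₁ e₂ : G.E) : G.E → ZMod 3 := fun e =>
  if e = e₁ then (G.sign v e₁ : ZMod 3)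
  else if e = e₂ then -(G.sign v e₂ : ZMod 3) else 0

/-- The dot product on `(ℤ/3)^{E(G)}`. -/
def dot (c φ : G.E → ZMod 3) : ZMod 3 := ∑ e : G.E, c e * φ e

/-- The subspace `Δ_v`: the span of `δ_v` if `deg v ≠ 3`, and the span of `δ_v`
together with the vectors `δ_{v,e₁,e₂}` for incident edges if `deg v = 3`. -/
def DeltaSub (v : G.V) : Submodule (ZMod 3) (G.E → ZMod 3) :=
  if G.degree v = 3 then
    Submodule.span (ZMod 3) ({G.deltaV v} ∪
      {x | ∃ e₁ e₂ : G.E, e₁ ≠ e₂ ∧ G.Incident v e₁ ∧ G.Incident v e₂ ∧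
        x = G.deltaPair v e₁ e₂})
  else Submodule.span (ZMod 3) {G.deltaV v}

/-- Isomorphism of multigraphs (edges may be reversed, since the orientation
is an arbitrary fixed choice). -/
def Iso (G H : MultiGraph) : Prop :=
  ∃ (f : G.V ≃ H.V) (g : G.E ≃ H.E), ∀ e : G.E,
    (H.tail (g e) = f (G.tail e) ∧ H.head (g e) = f (G.head e)) ∨
    (H.tail (g e) = f (G.head e) ∧ H.head (g e) = f (G.tail e))

/-- The graph with two vertices joined by `m` parallel edges. -/
def banana (m : ℕ) : MultiGraph where
  V := Bool
  E := Fin m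
  tail := fun _ => false
  head := fun _ => true

/-- The wheel `W_k`: a cycle on `k` vertices plus a hub (`none`) adjacent to all
of them.  `Sum.inl` are the cycle edges, `Sum.inr` the spokes. -/
def wheel (k : ℕ) : MultiGraph where
  V := Option (Fin k)
  E := Fin k ⊕ Fin k
  tail := fun e => Sum.elim (fun i => some i) (fun i => some i) e
  head := fun e => Sum.elim (fun i => some (finRotate k i)) (fun _ => none) e

/-- `K₂`. -/
def K2 : MultiGraph := banana 1

/-- `K₄` (the wheel on `3 + 1` vertices). -/
def K4 : MultiGraph := wheel 3

/-- `G` is a wheel. -/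
def IsWheel : Prop := ∃ k : ℕ, 3 ≤ k ∧ Iso G (wheel k)

end MultiGraph

namespace MultiGraph

section Flows

variable {G : MultiGraph}

theorem sign_cast (v : G.V) (e : G.E) : ((G.sign v e : ℤ) : ZMod 3) =
    (Pi.single v 1 : G.V → ZMod 3) (G.head e) - (Pi.single v 1 : G.V → ZMod 3) (G.tail e) := by
  simp [sign, Pi.single_apply]

theorem isFlow_iff_sum {φ : G.E → ZMod 3} :
    G.IsFlow φ ↔ ∀ v, ∑ e, (G.sign v e : ZMod 3) * φ e = 0 := by
  simp only [IsFlow, zsmul_eq_mul]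

/-- Flows are orthogonal to the coboundaries of all potentials. -/
theorem isFlow_iff_potential {φ : G.E → ZMod 3} :
    G.IsFlow φ ↔ ∀ p : G.V → ZMod 3, ∑ e, (p (G.head e) - p (G.tail e)) * φ e = 0 := by
  rw [isFlow_iff_sum]
  constructor
  · intro h p
    have key : ∀ e, p (G.head e) - p (G.tail e) = ∑ v, p v * (G.sign v e : ZMod 3) := by
      intro e
      simp [sign, mul_sub, Finset.sum_sub_distrib]
    simp_rw [key, Finset.sum_mul]
    rw [Finset.sum_comm]
    refine Finset.sum_eq_zero fun v _ => ?_
    simp_rw [mul_assoc, ← Finset.mul_sum, h v, mul_zero]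
  · intro h v
    simp_rw [sign_cast]
    exact h _

theorem contract_potential {e : G.E} {ψ : (G.contract {e}).E → ZMod 3}
    (hψ : (G.contract {e}).IsFlow ψ) (p : G.V → ZMod 3) (hp : p (G.tail e) = p (G.head e)) :
    ∑ f : {f : G.E // f ≠ e}, (p (G.head f) - p (G.tail f)) * ψ ⟨f.1, f.2⟩ = 0 := by
  have h := isFlow_iff_potential.1 hψ (Quot.lift p (by
    rintro a b ⟨e', he', rfl, rfl⟩
    rw [Set.mem_singleton_iff.1 he', hp]))
  refine Eq.trans ?_ h
  refine Finset.sum_bij (fun f _ => (⟨f.1, f.2⟩ : (G.contract {e}).E)) (fun _ _ => Finset.mem_univ _)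
    (fun a _ b _ hab => Subtype.ext (congrArg Subtype.val hab)) (fun b _ => ?_) (fun _ _ => rfl)
  exact ⟨⟨b.1, b.2⟩, Finset.mem_univ _, rfl⟩

/-- A nowhere-zero flow of `G / e` extends to a flow of `G`, with arbitrary value on `e`
if `e` is a loop. -/
theorem exists_flow_of_contract {e : G.E} (h : (G.contract {e}).HasNZFlow (ZMod 3)) :
    ∃ φ : G.E → ZMod 3, G.IsFlow φ ∧ (∀ f, f ≠ e → φ f ≠ 0) ∧
      (G.tail e = G.head e → φ e ≠ 0) := by
  obtain ⟨ψ, hψ, hnz⟩ := h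
  set x := G.tail e with hx
  set y := G.head e with hy
  set B : (G.V → ZMod 3) → ZMod 3 := fun p =>
    ∑ f : {f : G.E // f ≠ e}, (p (G.head f) - p (G.tail f)) * ψ ⟨f.1, f.2⟩ with hB
  set c : ZMod 3 := if x = y then 1 else B (Pi.single x 1) with hc
  refine ⟨fun f => if hf : f = e then c else ψ ⟨f, hf⟩, ?_, ?_, ?_⟩
  · rw [isFlow_iff_potential]
    intro p
    rw [Fintype.sum_eq_add_sum_subtype_ne _ e]
    have hsum : ∑ f : {f : G.E // f ≠ e}, (p (G.head f) - p (G.tail f)) *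
        (if hf : (f : G.E) = e then c else ψ ⟨f, hf⟩) = B p :=
      Finset.sum_congr rfl fun f _ => by rw [dif_neg f.2]
    rw [hsum, dif_pos rfl]
    by_cases hxy : x = y
    · have := contract_potential hψ p (by rw [← hx, ← hy, hxy])
      rw [← hx, ← hy, hxy, hB]
      simpa using this
    · have h0 := contract_potential hψ (p + (p y - p x) • Pi.single x 1) (by
        simp [← hx, ← hy, Ne.symm hxy])
      have h1 : B (p + (p y - p x) • Pi.single x 1) = B p + (p y - p x) * B (Pi.single x 1) := by
        simp only [hB, Finset.mul_sum, ← Finset.sum_add_distrib]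
        refine Finset.sum_congr rfl fun f _ => ?_
        simp only [Pi.add_apply, Pi.smul_apply, smul_eq_mul]
        ring
      rw [hc, if_neg hxy, add_comm, ← hy, ← hx, ← h1]
      exact h0
  · intro f hf
    simp only [dif_neg hf]
    exact hnz ⟨f, hf⟩
  · intro h
    simp [hc, h]

variable (G) in
/-- The edges incident with a vertex. -/
def star (v : G.V) : Finset G.E := univ.filter fun e => G.tail e = v ∨ G.head e = v

theorem mem_star {v : G.V} {e : G.E} : e ∈ G.star v ↔ G.tail e = v ∨ G.head e = v := by
  simp [star]

theorem card_star {v : G.V} (hl : ∀ e, G.tail e ≠ G.head e) :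
    (G.star v).card = G.degree v := by
  rw [star, Finset.filter_or, Finset.card_union_of_disjoint, degree]
  rw [Finset.disjoint_filter]
  intro e _ h1 h2
  exact hl e (h1.trans h2.symm)

theorem sum_degree : ∑ v, G.degree v = 2 * Fintype.card G.E := by
  simp only [degree, Finset.sum_add_distrib]
  rw [← Finset.card_eq_sum_card_fiberwise (fun _ _ => Finset.mem_univ _),
    ← Finset.card_eq_sum_card_fiberwise (fun _ _ => Finset.mem_univ _), Finset.card_univ]
  ring

theorem sign_ne_zero {v : G.V} {e : G.E} (hl : ∀ e, G.tail e ≠ G.head e) (h : e ∈ G.star v) :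
    (G.sign v e : ZMod 3) ≠ 0 := by
  have hle := hl e
  rcases mem_star.1 h with h | h
  · rw [h] at hle
    simp [sign, h, hle.symm]
  · rw [h] at hle
    simp [sign, h, hle]

theorem sign_eq_zero {v : G.V} {e : G.E} (h : e ∉ G.star v) : G.sign v e = 0 := by
  simp only [mem_star, not_or] at h
  simp [sign, h.1, h.2]

theorem IsFlow.sum_star {φ : G.E → ZMod 3} (h : G.IsFlow φ) (v : G.V) :
    ∑ e ∈ G.star v, (G.sign v e : ZMod 3) * φ e = 0 := by
  rw [← isFlow_iff_sum.1 h v]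
  refine Finset.sum_subset (Finset.subset_univ _) fun e _ he => ?_
  simp [sign_eq_zero he]

theorem star_eq_insert {v : G.V} {e₁ e₂ e₃ : G.E} (h : G.star v = {e₁, e₂, e₃}) (f : G.E) :
    f ∈ G.star v ↔ f = e₁ ∨ f = e₂ ∨ f = e₃ := by
  simp [h]

/-- The test vector at a vertex of degree three. -/
theorem exists_testVector {v : G.V} (hl : ∀ e, G.tail e ≠ G.head e) (hv : G.degree v = 3) :
    ∃ γ : G.E → ZMod 3,
      (∀ φ, G.IsFlow φ → (∀ e ∈ G.star v, φ e ≠ 0) → ∑ e, γ e * φ e = 0) ∧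
      (∀ φ, G.IsFlow φ → ∀ e ∈ G.star v, φ e = 0 → (∀ f, f ≠ e → φ f ≠ 0) →
        ∑ e, γ e * φ e ≠ 0) := by
  rw [← card_star hl] at hv
  obtain ⟨e₁, e₂, e₃, h12, h13, h23, hs⟩ := Finset.card_eq_three.1 hv
  have hs' := star_eq_insert hs
  have s1 := sign_ne_zero hl ((hs' e₁).2 (by simp))
  have s2 := sign_ne_zero hl ((hs' e₂).2 (by simp))
  have s3 := sign_ne_zero hl ((hs' e₃).2 (by simp))
  have hsum : ∀ φ, G.IsFlow φ → (G.sign v e₁ : ZMod 3) * φ e₁ + ((G.sign v e₂ : ZMod 3) * φ e₂ +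
      (G.sign v e₃ : ZMod 3) * φ e₃) = 0 := by
    intro φ hφ
    rw [← hφ.sum_star v, hs, Finset.sum_insert (by simp [h12, h13]), Finset.sum_pair h23]
  have hval : ∀ φ : G.E → ZMod 3, ∑ e, (Pi.single e₁ (G.sign v e₁ : ZMod 3) -
      Pi.single e₂ (G.sign v e₂ : ZMod 3) : G.E → ZMod 3) e * φ e =
      (G.sign v e₁ : ZMod 3) * φ e₁ - (G.sign v e₂ : ZMod 3) * φ e₂ := by
    intro φ
    simp [sub_mul, Finset.sum_sub_distrib, Pi.single_apply]
  refine ⟨Pi.single e₁ (G.sign v e₁ : ZMod 3) - Pi.single e₂ (G.sign v e₂ : ZMod 3),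
    fun φ hφ hne => ?_, fun φ hφ e he h0 hne => ?_⟩
  · rw [hval]
    have a1 := mul_ne_zero s1 (hne e₁ ((hs' e₁).2 (by simp)))
    have a2 := mul_ne_zero s2 (hne e₂ ((hs' e₂).2 (by simp)))
    have a3 := mul_ne_zero s3 (hne e₃ ((hs' e₃).2 (by simp)))
    have a4 := hsum φ hφ
    revert a1 a2 a3 a4
    generalize (G.sign v e₁ : ZMod 3) * φ e₁ = a
    generalize (G.sign v e₂ : ZMod 3) * φ e₂ = b
    generalize (G.sign v e₃ : ZMod 3) * φ e₃ = c
    revert a b c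
    decide
  · rw [hval]
    have a4 := hsum φ hφ
    rcases (hs' e).1 he with rfl | rfl | rfl
    · have a2 := mul_ne_zero s2 (hne _ h12.symm)
      simpa [h0] using a2
    · have a1 := mul_ne_zero s1 (hne _ h12)
      simpa [h0] using a1
    · have a1 := mul_ne_zero s1 (hne _ h13)
      have a2 := mul_ne_zero s2 (hne _ h23)
      rw [h0, mul_zero, add_zero] at a4
      revert a1 a2 a4
      generalize (G.sign v e₁ : ZMod 3) * φ e₁ = a
      generalize (G.sign v e₂ : ZMod 3) * φ e₂ = b
      revert a b
      decide

end Flows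

/-- A loopless connected graph without a nowhere-zero flow, together with flows `φ e`
vanishing on `e` only, and test vectors `γ v` at the vertices of degree three. -/
structure CriticalData (G : MultiGraph) where
  conn : G.Connected
  noFlow : ¬ G.HasNZFlow (ZMod 3)
  loopless : ∀ e, G.tail e ≠ G.head e
  φ : G.E → G.E → ZMod 3
  flow : ∀ e, G.IsFlow (φ e)
  self : ∀ e, φ e e = 0
  ne : ∀ e f, f ≠ e → φ e f ≠ 0
  γ : G.V → G.E → ZMod 3
  γ_eq_zero : ∀ v, G.degree v = 3 → ∀ ψ, G.IsFlow ψ → (∀ e ∈ G.star v, ψ e ≠ 0) →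
    ∑ e, γ v e * ψ e = 0
  γ_ne_zero : ∀ v, G.degree v = 3 → ∀ ψ, G.IsFlow ψ → ∀ e ∈ G.star v, ψ e = 0 →
    (∀ f, f ≠ e → ψ f ≠ 0) → ∑ e, γ v e * ψ e ≠ 0

theorem FlowCritical.exists_criticalData {G : MultiGraph} (h : G.FlowCritical (ZMod 3)) :
    Nonempty (CriticalData G) := by
  obtain ⟨hc, hno, hcon⟩ := h
  choose φ hφ hne hloop using fun e => exists_flow_of_contract (hcon e)
  have hz : ∀ e, φ e e = 0 := by
    intro e
    by_contra h
    refine hno ⟨φ e, hφ e, fun f => ?_⟩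
    by_cases hf : f = e
    · rwa [hf]
    · exact hne e f hf
  have hl : ∀ e, G.tail e ≠ G.head e := fun e he => hloop e he (hz e)
  have hγ : ∀ v, ∃ γ : G.E → ZMod 3, G.degree v = 3 → _ := fun v => by
    by_cases hv : G.degree v = 3
    · obtain ⟨γ, h⟩ := exists_testVector hl hv
      exact ⟨γ, fun _ => h⟩
    · exact ⟨0, fun h => absurd h hv⟩
  choose γ hγ using hγ
  exact ⟨⟨hc, hno, hl, φ, hφ, hz, hne, γ, fun v hv => (hγ v hv).1, fun v hv => (hγ v hv).2⟩⟩

namespace CriticalData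

variable {G : MultiGraph}

theorem exists_mem_star (D : CriticalData G) (v : G.V) : ∃ e, e ∈ G.star v := by
  have : ∃ b, b ≠ v := by
    by_contra! h
    exact D.noFlow ⟨fun _ => 1, fun w => Finset.sum_eq_zero fun e _ =>
      absurd ((h _).trans (h _).symm) (D.loopless e), fun e => one_ne_zero⟩
  obtain ⟨b, hb⟩ := this
  rcases (D.conn.2 v b).cases_head with h | ⟨c, ⟨e, he⟩, -⟩
  · exact absurd h.symm hb
  · exact ⟨e, mem_star.2 (he.imp And.left And.right)⟩

/-- A property inherited along edges holds everywhere once it holds somewhere. -/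
theorem forall_of_edges (D : CriticalData G) {P : G.V → Prop}
    (hP : ∀ e, P (G.tail e) ↔ P (G.head e)) {a : G.V} (ha : P a) (b : G.V) : P b := by
  induction D.conn.2 a b with
  | refl => exact ha
  | tail _ h ih =>
    obtain ⟨e, ⟨rfl, rfl⟩ | ⟨rfl, rfl⟩⟩ := h
    · exact (hP e).1 ih
    · exact (hP e).2 ih

theorem iso_K2_of_unique (D : CriticalData G) {e : G.E} (he : ∀ f, f = e) : Iso G K2 := by
  classical
  have hV : ∀ v, v = G.tail e ∨ v = G.head e := by
    intro v
    obtain ⟨f, hf⟩ := D.exists_mem_star v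
    rw [he f, mem_star] at hf
    exact hf.imp Eq.symm Eq.symm
  have hl := D.loopless e
  refine ⟨⟨fun v => decide (v = G.head e), fun b => cond b (G.head e) (G.tail e), ?_, ?_⟩,
    ⟨fun _ => (0 : Fin 1), fun _ => e, fun f => (he f).symm, fun (i : Fin 1) =>
      Subsingleton.elim (α := Fin 1) _ _⟩, ?_⟩
  · intro v
    rcases hV v with rfl | rfl
    · simp [hl]
    · simp
  · rintro (_ | _)
    · exact decide_eq_false hl
    · exact decide_eq_true rfl
  · intro f
    left
    rw [he f]
    exact ⟨(decide_eq_false hl).symm, (decide_eq_true rfl).symm⟩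

theorem three_le_degree (D : CriticalData G) (hK2 : ¬ Iso G K2) (v : G.V) : 3 ≤ G.degree v := by
  by_contra! hlt
  rw [← card_star D.loopless] at hlt
  obtain ⟨e, he⟩ := D.exists_mem_star v
  have hcard : (G.star v).card = 1 ∨ (G.star v).card = 2 := by
    have := Finset.card_pos.2 ⟨e, he⟩
    omega
  rcases hcard with h | h
  · obtain ⟨e', hs⟩ := Finset.card_eq_one.1 h
    refine hK2 (D.iso_K2_of_unique (e := e') fun f => ?_)
    by_contra hf
    have h1 := (D.flow f).sum_star v
    rw [hs, Finset.sum_singleton] at h1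
    exact mul_ne_zero (sign_ne_zero D.loopless (by simp [hs])) (D.ne f e' (Ne.symm hf)) h1
  · obtain ⟨a, b, hab, hs⟩ := Finset.card_eq_two.1 h
    have h1 := (D.flow a).sum_star v
    rw [hs, Finset.sum_pair hab, D.self, mul_zero, zero_add] at h1
    exact mul_ne_zero (sign_ne_zero D.loopless (by simp [hs])) (D.ne a b hab.symm) h1

/-- There are no parallel edges. -/
theorem simple (D : CriticalData G) {e f : G.E}
    (h : (G.tail e = G.tail f ∧ G.head e = G.head f) ∨
      (G.tail e = G.head f ∧ G.head e = G.tail f)) : e = f := by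
  by_contra hef
  obtain ⟨ε, hε0, hε⟩ : ∃ ε : ZMod 3, ε * ε = 1 ∧ ∀ p : G.V → ZMod 3,
      p (G.head f) - p (G.tail f) = ε * (p (G.head e) - p (G.tail e)) := by
    rcases h with ⟨h1, h2⟩ | ⟨h1, h2⟩
    · exact ⟨1, by decide, fun p => by rw [h1, h2]; ring⟩
    · exact ⟨-1, by decide, fun p => by rw [h1, h2]; ring⟩
  have hx := D.ne e f (Ne.symm hef)
  set x := D.φ e f with hxdef
  refine D.noFlow ⟨D.φ e + (Pi.single e (-ε * x) + Pi.single f x), ?_, fun g => ?_⟩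
  · rw [isFlow_iff_potential]
    intro p
    have h0 := isFlow_iff_potential.1 (D.flow e) p
    simp only [Pi.add_apply, mul_add, Finset.sum_add_distrib, h0, Pi.single_apply, mul_ite,
      mul_zero, Finset.sum_ite_eq', Finset.mem_univ, if_true, hε]
    ring
  · by_cases hge : g = e
    · subst hge
      have : ε ≠ 0 := by
        rintro rfl
        simp at hε0
      simp [D.self, hef, this, hx]
    · by_cases hgf : g = f
      · subst hgf
        simp only [Pi.add_apply, ← hxdef, Pi.single_apply, hge, if_false, if_true]
        revert hx
        generalize x = y
        revert y
        decide
      · simpa [hge, hgf] using D.ne e g hge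

end CriticalData

end MultiGraph

namespace MultiGraph.CriticalData

variable {G : MultiGraph}

theorem γ_φ_eq_zero (D : CriticalData G) {v : G.V} (hv : G.degree v = 3) {e : G.E}
    (he : e ∉ G.star v) : ∑ f, D.γ v f * D.φ e f = 0 :=
  D.γ_eq_zero v hv _ (D.flow e) fun f hf => D.ne e f (by rintro rfl; exact he hf)

theorem γ_φ_ne_zero (D : CriticalData G) {v : G.V} (hv : G.degree v = 3) {e : G.E}
    (he : e ∈ G.star v) : ∑ f, D.γ v f * D.φ e f ≠ 0 :=
  D.γ_ne_zero v hv _ (D.flow e) e he (D.self e) (D.ne e)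

/-- The linear combination of vertex vectors and test vectors with given coefficients. -/
def comb (D : CriticalData G) :
    (G.V → ZMod 3) × ({v // G.degree v = 3} → ZMod 3) →ₗ[ZMod 3] (G.E → ZMod 3) where
  toFun c e := c.1 (G.head e) - c.1 (G.tail e) + ∑ v, c.2 v * D.γ v e
  map_add' c d := by
    ext e
    simp only [Prod.fst_add, Prod.snd_add, Pi.add_apply, add_mul, Finset.sum_add_distrib]
    ring
  map_smul' r c := by
    ext e
    simp only [Prod.smul_fst, Prod.smul_snd, Pi.smul_apply, smul_eq_mul, RingHom.id_apply,
      mul_add, Finset.mul_sum, mul_assoc]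
    ring

theorem sum_comb_mul (D : CriticalData G)
    (c : (G.V → ZMod 3) × ({v // G.degree v = 3} → ZMod 3)) {ψ : G.E → ZMod 3}
    (hψ : G.IsFlow ψ) :
    ∑ e, D.comb c e * ψ e = ∑ v, c.2 v * ∑ e, D.γ v e * ψ e := by
  have h := isFlow_iff_potential.1 hψ c.1
  simp only [comb, LinearMap.coe_mk, AddHom.coe_mk, add_mul, Finset.sum_add_distrib, h, zero_add,
    Finset.sum_mul, Finset.mul_sum]
  rw [Finset.sum_comm]
  simp only [mul_assoc]

theorem support_step (D : CriticalData G)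
    {c : (G.V → ZMod 3) × ({v // G.degree v = 3} → ZMod 3)} (hc : D.comb c = 0)
    {e : G.E} {x y : G.V} (hx : e ∈ G.star x) (hxy : ∀ w, e ∈ G.star w → w = x ∨ w = y)
    (h : ∃ h, c.2 ⟨x, h⟩ ≠ 0) : ∃ h, c.2 ⟨y, h⟩ ≠ 0 := by
  obtain ⟨hx3, hne⟩ := h
  by_contra! hy
  have h0 := D.sum_comb_mul c (D.flow e)
  rw [Finset.sum_eq_single (⟨x, hx3⟩ : {v // G.degree v = 3})] at h0
  · simp only [hc, Pi.zero_apply, zero_mul, Finset.sum_const_zero] at h0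
    exact mul_ne_zero hne (D.γ_φ_ne_zero hx3 hx) h0.symm
  · rintro ⟨w, hw3⟩ - hwx
    by_cases hw : e ∈ G.star w
    · rcases hxy w hw with rfl | rfl
      · exact absurd rfl hwx
      · rw [hy hw3, zero_mul]
    · rw [D.γ_φ_eq_zero hw3 hw, mul_zero]
  · simp

theorem support_all (D : CriticalData G)
    {c : (G.V → ZMod 3) × ({v // G.degree v = 3} → ZMod 3)} (hc : D.comb c = 0)
    {x : G.V} (h : ∃ h, c.2 ⟨x, h⟩ ≠ 0) (y : G.V) : ∃ h, c.2 ⟨y, h⟩ ≠ 0 := by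
  refine D.forall_of_edges (P := fun y => ∃ h, c.2 ⟨y, h⟩ ≠ 0) (fun e => ⟨?_, ?_⟩) h y
  · exact D.support_step hc (mem_star.2 (Or.inl rfl))
      fun w hw => (mem_star.1 hw).imp Eq.symm Eq.symm
  · exact D.support_step hc (mem_star.2 (Or.inr rfl))
      fun w hw => ((mem_star.1 hw).imp Eq.symm Eq.symm).symm

theorem eq_zero_of_comb (D : CriticalData G)
    {c : (G.V → ZMod 3) × ({v // G.degree v = 3} → ZMod 3)} (hc : D.comb c = 0)
    {x a : G.V} (hx : ∀ h, c.2 ⟨x, h⟩ = 0) (ha : c.1 a = 0) : c = 0 := by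
  have h2 : c.2 = 0 := by
    ext ⟨v, hv⟩
    by_contra hne
    obtain ⟨h, h'⟩ := D.support_all hc ⟨hv, hne⟩ x
    exact h' (hx h)
  refine Prod.ext (funext fun b => ?_) h2
  refine D.forall_of_edges (P := fun b => c.1 b = 0) (fun e => ?_) ha b
  have he := congrFun hc e
  simp only [comb, LinearMap.coe_mk, AddHom.coe_mk, h2, Pi.zero_apply, zero_mul,
    Finset.sum_const_zero, add_zero, sub_eq_zero] at he
  rw [he]

theorem card_cubic_le (D : CriticalData G) (h3 : ∀ v, G.degree v = 3) :
    2 * Fintype.card G.V ≤ Fintype.card G.E + 2 := by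
  obtain ⟨⟨a⟩, -⟩ := D.conn
  let L : (G.V → ZMod 3) × ({v // G.degree v = 3} → ZMod 3) →ₗ[ZMod 3]
      (G.E → ZMod 3) × (ZMod 3 × ZMod 3) :=
    D.comb.prod (((LinearMap.proj a).comp (LinearMap.fst _ _ _)).prod
      ((LinearMap.proj ⟨a, h3 a⟩).comp (LinearMap.snd _ _ _)))
  have hL : Function.Injective L := by
    rw [injective_iff_map_eq_zero]
    intro c hc
    exact D.eq_zero_of_comb (congrArg Prod.fst hc)
      (fun _ => congrArg (fun p => p.2.2) hc) (congrArg (fun p => p.2.1) hc)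
  have := LinearMap.finrank_le_finrank_of_injective hL
  simp only [Module.finrank_prod, Module.finrank_pi, Module.finrank_self] at this
  rw [Fintype.card_subtype, Finset.filter_true_of_mem fun v _ => h3 v, Finset.card_univ] at this
  omega

/-- If some vertex does not have degree three, then the vertex and test vectors have a single
linear relation; when they span, a flow orthogonal to all test vectors vanishes. -/
theorem card_add_card_le (D : CriticalData G) {z : G.V} (hz : G.degree z ≠ 3) :
    Fintype.card G.V + Fintype.card {v // G.degree v = 3} ≤ Fintype.card G.E + 1 ∧
    (Fintype.card G.V + Fintype.card {v // G.degree v = 3} = Fintype.card G.E + 1 →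
      ∀ ψ, G.IsFlow ψ → (∀ v, G.degree v = 3 → ∑ e, D.γ v e * ψ e = 0) → ψ = 0) := by
  let L : (G.V → ZMod 3) × ({v // G.degree v = 3} → ZMod 3) →ₗ[ZMod 3]
      (G.E → ZMod 3) × ZMod 3 :=
    D.comb.prod ((LinearMap.proj z).comp (LinearMap.fst _ _ _))
  have hL : Function.Injective L := by
    rw [injective_iff_map_eq_zero]
    intro c hc
    exact D.eq_zero_of_comb (congrArg Prod.fst hc) (fun h => absurd h hz) (congrArg Prod.snd hc)
  constructor
  · have := LinearMap.finrank_le_finrank_of_injective hL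
    simpa only [Module.finrank_prod, Module.finrank_pi, Module.finrank_self] using this
  · intro hcard ψ hψ h0
    have hs : Function.Surjective L :=
      (LinearMap.injective_iff_surjective_of_finrank_eq_finrank (by
        simpa only [Module.finrank_prod, Module.finrank_pi, Module.finrank_self] using hcard)).1 hL
    ext e
    obtain ⟨c, hc⟩ := hs (Pi.single e 1, 0)
    have hc1 : D.comb c = Pi.single e 1 := congrArg Prod.fst hc
    have := D.sum_comb_mul c hψ
    rw [hc1, Finset.sum_eq_zero fun (v : {v // G.degree v = 3}) _ => by
      rw [h0 v v.2, mul_zero]] at this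
    simpa [Pi.single_apply] using this

end MultiGraph.CriticalData

namespace MultiGraph

variable {G : MultiGraph}

theorem Adj.symm {a b : G.V} (h : G.Adj a b) : G.Adj b a :=
  h.imp fun _ h => h.symm

open Classical in
/-- The neighbours of a vertex. -/
noncomputable def nbrs (G : MultiGraph) (v : G.V) : Finset G.V := univ.filter (G.Adj v)

theorem mem_nbrs {v w : G.V} : w ∈ G.nbrs v ↔ G.Adj v w := by
  simp [nbrs]

theorem mem_nbrs_comm {v w : G.V} : w ∈ G.nbrs v ↔ v ∈ G.nbrs w := by
  simp only [mem_nbrs]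
  exact ⟨Adj.symm, Adj.symm⟩

theorem mem_nbrs_iff_star {v w : G.V} (hvw : v ≠ w) :
    w ∈ G.nbrs v ↔ ∃ e, e ∈ G.star v ∧ e ∈ G.star w := by
  simp only [mem_nbrs, Adj, mem_star]
  refine exists_congr fun e => ⟨?_, ?_⟩
  · tauto
  · rintro ⟨h1 | h1, h2 | h2⟩
    · exact absurd (h1.symm.trans h2) hvw
    · exact Or.inl ⟨h1, h2⟩
    · exact Or.inr ⟨h2, h1⟩
    · exact absurd (h1.symm.trans h2) hvw

theorem eq_or_eq_of_mem_star {e : G.E} {v w x : G.V} (hvw : v ≠ w) (hv : e ∈ G.star v)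
    (hw : e ∈ G.star w) (hx : e ∈ G.star x) : x = v ∨ x = w := by
  rw [mem_star] at hv hw hx
  grind

/-- A graph all of whose vertices but `z` have degree three has a nowhere-zero flow if the
vertices other than `z` can be properly coloured by signs. -/
theorem hasNZFlow_of_bipartite (hl : ∀ e, G.tail e ≠ G.head e) {z : G.V}
    (h3 : ∀ v, v ≠ z → G.degree v = 3) (s : G.V → ZMod 3) (hs : ∀ v, v ≠ z → s v ≠ 0)
    (hopp : ∀ e, G.tail e ≠ z → G.head e ≠ z → s (G.head e) = -s (G.tail e)) :
    G.HasNZFlow (ZMod 3) := by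
  set φ : G.E → ZMod 3 := fun e => if G.head e = z then -s (G.tail e) else s (G.head e) with hφ
  have hnet : ∀ v, v ≠ z → ∑ e, (G.sign v e : ZMod 3) * φ e = 0 := by
    intro v hv
    have h1 : ∀ e ∈ G.star v, (G.sign v e : ZMod 3) * φ e = s v := by
      intro e he
      have hle := hl e
      rcases mem_star.1 he with rfl | rfl
      · by_cases hz : G.head e = z
        · simp [sign, hφ, hz, hv.symm]
        · simp [sign, hφ, hle.symm, hz, hopp e hv hz]
      · simp [sign, hφ, hle, hv]
    have h2 : ∑ e ∈ G.star v, (G.sign v e : ZMod 3) * φ e = 0 := by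
      rw [Finset.sum_congr rfl h1, Finset.sum_const, card_star hl, h3 v hv]
      generalize s v = a
      revert a
      decide
    rw [← h2]
    refine (Finset.sum_subset (Finset.subset_univ _) fun e _ he => ?_).symm
    simp [sign_eq_zero he]
  refine ⟨φ, isFlow_iff_sum.2 fun v => ?_, fun e => ?_⟩
  · by_cases hv : v = z
    · subst hv
      have htot : ∑ w, ∑ e, (G.sign w e : ZMod 3) * φ e = 0 := by
        rw [Finset.sum_comm]
        refine Finset.sum_eq_zero fun e _ => ?_
        rw [← Finset.sum_mul]
        simp [sign]
      rwa [Finset.sum_eq_single v (fun w _ hw => hnet w hw) (by simp)] at htot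
    · exact hnet v hv
  · by_cases hz : G.head e = z
    · simp only [hφ, hz, if_true]
      exact neg_ne_zero.2 (hs _ (hz ▸ hl e))
    · simp only [hφ, hz, if_false]
      exact hs _ hz

theorem K4_adj (a b : Option (Fin 3)) (h : a ≠ b) : ∃ e : Fin 3 ⊕ Fin 3,
    ((wheel 3).tail e = a ∧ (wheel 3).head e = b) ∨
    ((wheel 3).tail e = b ∧ (wheel 3).head e = a) := by
  revert a b
  simp only [wheel]
  decide

namespace CriticalData

theorem card_nbrs (D : CriticalData G) (v : G.V) : (G.nbrs v).card = G.degree v := by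
  rw [← card_star D.loopless]
  symm
  refine Finset.card_bij (fun e _ => if G.tail e = v then G.head e else G.tail e) ?_ ?_ ?_
  · intro e he
    rw [mem_nbrs]
    refine ⟨e, ?_⟩
    rw [mem_star] at he
    split_ifs with h
    · exact Or.inl ⟨h, rfl⟩
    · exact Or.inr ⟨rfl, he.resolve_left h⟩
  · intro e he f hf hef
    rw [mem_star] at he hf
    refine D.simple ?_
    have := D.loopless e
    have := D.loopless f
    grind
  · intro w hw
    have hl := D.loopless
    obtain ⟨e, ⟨h1, h2⟩ | ⟨h1, h2⟩⟩ := mem_nbrs.1 hw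
    · exact ⟨e, mem_star.2 (Or.inl h1), by simp [h1, h2]⟩
    · exact ⟨e, mem_star.2 (Or.inr h2), by rw [if_neg (h2 ▸ hl e), h1]⟩

theorem not_mem_nbrs_self (D : CriticalData G) (v : G.V) : v ∉ G.nbrs v := by
  rw [mem_nbrs]
  rintro ⟨e, ⟨h1, h2⟩ | ⟨h1, h2⟩⟩ <;> exact D.loopless e (h1.trans h2.symm)

theorem degree_lt_card (D : CriticalData G) (v : G.V) : G.degree v < Fintype.card G.V := by
  rw [← D.card_nbrs, ← Finset.card_univ]
  refine Finset.card_lt_card (Finset.ssubset_univ_iff.2 fun h => D.not_mem_nbrs_self v ?_)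
  rw [h]
  exact Finset.mem_univ v

theorem iso_K4 (D : CriticalData G) (hV : Fintype.card G.V = 4) (hE : Fintype.card G.E = 6) :
    Iso G K4 := by
  let f : G.V ≃ Option (Fin 3) := Fintype.equivOfCardEq (by simp [hV])
  choose g hg using fun e : G.E => K4_adj (f (G.tail e)) (f (G.head e))
    fun h => D.loopless e (f.injective h)
  have hinj : Function.Injective g := by
    intro a b hab
    have ha := hg a
    have hb := hg b
    rw [hab] at ha
    refine D.simple ?_
    simp only [← f.injective.eq_iff]
    grind
  have hbij : Function.Bijective g :=
    (Fintype.bijective_iff_injective_and_card g).2 ⟨hinj, by simp [hE]⟩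
  refine ⟨f, Equiv.ofBijective g hbij, fun e => ?_⟩
  exact hg e

/-- The case of a graph that looks like the wheel with four spokes. -/
theorem false_of_card_five (D : CriticalData G) (hV : Fintype.card G.V = 5) {z : G.V}
    (h3 : ∀ v, v ≠ z → G.degree v = 3) (hz : ∀ v, v ≠ z → z ∈ G.nbrs v) : False := by
  classical
  obtain ⟨x, hxz⟩ := Fintype.exists_ne_of_one_lt_card (by omega) z
  have hfew : ∀ y, y ≠ z → ∀ A : Finset G.V, A.card = 3 → (∀ a ∈ A, a ∉ G.nbrs y) → False := by
    intro y hy A hA hd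
    have h1 : Disjoint A (G.nbrs y) := Finset.disjoint_left.2 hd
    have h2 := Finset.card_le_univ (A ∪ G.nbrs y)
    rw [Finset.card_union_of_disjoint h1, D.card_nbrs, h3 y hy] at h2
    omega
  have hnb : ∀ a b c, a ≠ z → b ≠ z → c ≠ z → b ≠ c → b ∈ G.nbrs a → c ∈ G.nbrs a →
      G.nbrs a = {z, b, c} := by
    intro a b c ha hb hc hbc hab hac
    symm
    refine Finset.eq_of_subset_of_card_le ?_ ?_
    · intro w hw
      simp only [Finset.mem_insert, Finset.mem_singleton] at hw
      rcases hw with rfl | rfl | rfl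
      exacts [hz a ha, hab, hac]
    · rw [D.card_nbrs, h3 a ha, Finset.card_eq_three.2 ⟨z, b, c, hb.symm, hc.symm, hbc, rfl⟩]
  have hpar : ∀ u w, u ≠ z → w ≠ z → w ∈ G.nbrs u → (u ∈ G.nbrs x ↔ w ∉ G.nbrs x) := by
    intro u w hu hw huw
    have hne : u ≠ w := by
      rintro rfl
      exact D.not_mem_nbrs_self _ huw
    constructor
    · intro hux hwx
      have hxu : x ≠ u := by
        rintro rfl
        exact D.not_mem_nbrs_self _ hux
      have hxw : x ≠ w := by
        rintro rfl
        exact D.not_mem_nbrs_self _ hwx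
      have e1 := hnb x u w hxz hu hw hne hux hwx
      have e2 := hnb u x w hu hxz hw hxw (mem_nbrs_comm.1 hux) huw
      have e3 := hnb w x u hw hxz hu hxu (mem_nbrs_comm.1 hwx) (mem_nbrs_comm.1 huw)
      obtain ⟨y, hy⟩ : ∃ y, y ∉ ({z, x, u, w} : Finset G.V) := by
        by_contra! h
        have h1 := Finset.card_le_card (fun y _ => h y : (univ : Finset G.V) ⊆ _)
        rw [Finset.card_univ, hV] at h1
        exact absurd (h1.trans Finset.card_le_four) (by norm_num)
      simp only [Finset.mem_insert, Finset.mem_singleton, not_or] at hy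
      refine hfew y hy.1 {x, u, w} (Finset.card_eq_three.2 ⟨x, u, w, hxu, hxw, hne, rfl⟩) ?_
      intro a ha
      rw [mem_nbrs_comm]
      simp only [Finset.mem_insert, Finset.mem_singleton] at ha
      rcases ha with rfl | rfl | rfl <;> simp [e1, e2, e3, hy]
    · intro hwx
      by_contra hux
      have hxu : x ≠ u := by
        rintro rfl
        exact hwx huw
      have hxw : x ≠ w := by
        rintro rfl
        exact hux (mem_nbrs_comm.1 huw)
      refine hfew x hxz {x, u, w} (Finset.card_eq_three.2 ⟨x, u, w, hxu, hxw, hne, rfl⟩) ?_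
      intro a ha
      simp only [Finset.mem_insert, Finset.mem_singleton] at ha
      rcases ha with rfl | rfl | rfl
      exacts [D.not_mem_nbrs_self _, hux, hwx]
  refine D.noFlow (hasNZFlow_of_bipartite D.loopless h3
    (fun v => if v ∈ G.nbrs x then 1 else -1) (fun v _ => ?_) fun e h1 h2 => ?_)
  · split_ifs <;> decide
  · have := hpar _ _ h1 h2 (mem_nbrs.2 ⟨e, Or.inl ⟨rfl, rfl⟩⟩)
    by_cases h : G.head e ∈ G.nbrs x <;> simp [this, h]

theorem exists_ne_edge (D : CriticalData G) (hK2 : ¬ Iso G K2) (e : G.E) : ∃ f, f ≠ e := by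
  by_contra! h
  exact hK2 (D.iso_K2_of_unique h)

theorem bound (D : CriticalData G) (hK2 : ¬ Iso G K2) (hK4 : ¬ Iso G K4) :
    5 * Fintype.card G.V ≤ 3 * Fintype.card G.E := by
  by_contra! hlt
  have hsum := G.sum_degree
  by_cases h3 : ∀ v, G.degree v = 3
  · have h1 := D.card_cubic_le h3
    obtain ⟨⟨a⟩, -⟩ := D.conn
    have h2 := D.degree_lt_card a
    rw [h3 a] at h2
    simp only [h3, Finset.sum_const, Finset.card_univ, smul_eq_mul] at hsum
    exact hK4 (D.iso_K4 (by omega) (by omega))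
  push Not at h3
  obtain ⟨z, hz⟩ := h3
  set N := univ.filter fun v : G.V => G.degree v ≠ 3 with hN
  have memN : ∀ v, v ∈ N ↔ G.degree v ≠ 3 := by simp [hN]
  obtain ⟨hle, hinj⟩ := D.card_add_card_le hz
  have hn : Fintype.card {v // G.degree v = 3} + N.card = Fintype.card G.V := by
    rw [Fintype.card_subtype, hN, Finset.card_filter_add_card_filter_not, Finset.card_univ]
  have hNsum : 4 * N.card ≤ ∑ v ∈ N, G.degree v := by
    rw [mul_comm, ← smul_eq_mul]
    refine Finset.card_nsmul_le_sum _ _ _ fun v hv => ?_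
    have := D.three_le_degree hK2 v
    have := (memN v).1 hv
    omega
  have hsplit : 3 * Fintype.card {v // G.degree v = 3} + ∑ v ∈ N, G.degree v =
      2 * Fintype.card G.E := by
    rw [← hsum, ← Finset.sum_filter_add_sum_filter_not univ fun v => G.degree v = 3,
      Finset.sum_congr rfl fun v hv => (Finset.mem_filter.1 hv).2, Finset.sum_const,
      Fintype.card_subtype, smul_eq_mul, mul_comm]
  replace hinj := hinj (by omega)
  -- A vertex of degree three lies on at most one edge towards `N`.
  have huniq : ∀ v, G.degree v = 3 → ∀ e e', e ∈ G.star v → e' ∈ G.star v →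
      (∃ w ∈ N, e ∈ G.star w) → (∃ w ∈ N, e' ∈ G.star w) → e = e' := by
    rintro v hv e e' he he' ⟨w, hw, hew⟩ ⟨w', hw', hew'⟩
    by_contra hne
    have hval : ∀ (f : G.E) (y : G.V), y ∈ N → f ∈ G.star v → f ∈ G.star y →
        ∀ x, G.degree x = 3 → x ≠ v → ∑ i, D.γ x i * D.φ f i = 0 := by
      intro f y hy hf hfy x hx hxv
      refine D.γ_φ_eq_zero hx fun hfx => ?_
      have hyv : v ≠ y := by
        rintro rfl
        exact (memN _).1 hy hv
      rcases eq_or_eq_of_mem_star hyv hf hfy hfx with rfl | rfl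
      · exact hxv rfl
      · exact (memN _).1 hy hx
    set α := ∑ i, D.γ v i * D.φ e i with hα
    set β := ∑ i, D.γ v i * D.φ e' i with hβ
    have hα0 : α ≠ 0 := D.γ_φ_ne_zero hv he
    have hψ := hinj (fun i => β * D.φ e i - α * D.φ e' i) ?_ ?_
    · have := congrFun hψ e
      simp only [D.self, mul_zero, zero_sub, Pi.zero_apply, neg_eq_zero] at this
      exact mul_ne_zero hα0 (D.ne e' e hne) this
    · rw [isFlow_iff_potential]
      intro p
      have h1 := isFlow_iff_potential.1 (D.flow e) p
      have h2 := isFlow_iff_potential.1 (D.flow e') p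
      simp only [mul_sub, mul_left_comm _ β, mul_left_comm _ α, Finset.sum_sub_distrib,
        ← Finset.mul_sum, h1, h2, mul_zero, sub_zero]
    · intro x hx
      simp only [mul_sub, mul_left_comm _ β, mul_left_comm _ α, Finset.sum_sub_distrib,
        ← Finset.mul_sum]
      by_cases hxv : x = v
      · subst hxv
        rw [← hα, ← hβ]
        ring
      · rw [hval e w hw he hew x hx hxv, hval e' w' hw' he' hew' x hx hxv]
        ring
  have hindep : ∀ w ∈ N, ∀ v ∈ G.nbrs w, G.degree v = 3 := by
    intro w hw v hvw
    by_contra hv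
    have hne : w ≠ v := by
      rintro rfl
      exact D.not_mem_nbrs_self _ hvw
    obtain ⟨e, hew, hev⟩ := (mem_nbrs_iff_star hne).1 hvw
    obtain ⟨f, hf⟩ := D.exists_ne_edge hK2 e
    refine D.ne e f hf (congrFun (hinj _ (D.flow e) fun x hx => D.γ_φ_eq_zero hx fun hex => ?_) f)
    rcases eq_or_eq_of_mem_star hne hew hev hex with rfl | rfl
    · exact (memN _).1 hw hx
    · exact hv hx
  have hcount : ∑ w ∈ N, G.degree w ≤ Fintype.card {v // G.degree v = 3} := by
    have hdisj : (N : Set G.V).PairwiseDisjoint G.nbrs := by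
      intro w hw w' hw' hne
      refine Finset.disjoint_left.2 fun v hv hv' => hne ?_
      have hv3 := hindep w hw v hv
      have hwv : w ≠ v := by
        rintro rfl
        exact (memN _).1 hw hv3
      have hwv' : w' ≠ v := by
        rintro rfl
        exact (memN _).1 hw' hv3
      obtain ⟨e, he1, he2⟩ := (mem_nbrs_iff_star hwv).1 hv
      obtain ⟨e', he1', he2'⟩ := (mem_nbrs_iff_star hwv').1 hv'
      obtain rfl := huniq v hv3 e e' he2 he2' ⟨w, hw, he1⟩ ⟨w', hw', he1'⟩
      exact ((eq_or_eq_of_mem_star hwv he1 he2 he1').resolve_right hwv').symm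
    simp only [← D.card_nbrs]
    rw [← Finset.card_biUnion hdisj]
    simp only [D.card_nbrs]
    rw [Fintype.card_subtype]
    refine Finset.card_le_card fun v hv => ?_
    obtain ⟨w, hw, hvw⟩ := Finset.mem_biUnion.1 hv
    exact Finset.mem_filter.2 ⟨Finset.mem_univ _, hindep w hw v hvw⟩
  have hNpos : 0 < N.card := Finset.card_pos.2 ⟨z, (memN z).2 hz⟩
  have hN1 : N.card = 1 := by omega
  have hV : Fintype.card G.V = 5 := by omega
  have h3 : ∀ v, v ≠ z → G.degree v = 3 := by
    intro v hv
    by_contra h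
    exact hv (Finset.card_le_one.1 hN1.le v ((memN v).2 h) z ((memN z).2 hz))
  refine D.false_of_card_five hV h3 fun v hv => ?_
  rw [mem_nbrs_comm]
  have hsub : G.nbrs z = univ.erase z := by
    refine Finset.eq_of_subset_of_card_le (fun w hw => ?_) ?_
    · refine Finset.mem_erase.2 ⟨?_, Finset.mem_univ _⟩
      rintro rfl
      exact D.not_mem_nbrs_self _ hw
    · rw [Finset.card_erase_of_mem (Finset.mem_univ _), Finset.card_univ, hV, D.card_nbrs]
      have := D.three_le_degree hK2 z
      omega
  rw [hsub]
  exact Finset.mem_erase.2 ⟨hv, Finset.mem_univ _⟩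

end CriticalData

end MultiGraph

open MultiGraph in
/-- Every `n`-vertex `ℤ/3`-flow-critical graph `F` other than `K₂` and `K₄`
satisfies `|E(F)| ≥ (5/3) n`. -/
theorem edges_ge_five_thirds (F : MultiGraph)
    (hF : F.FlowCritical (ZMod 3)) (hK2 : ¬ Iso F K2) (hK4 : ¬ Iso F K4) :
    3 * Fintype.card F.E ≥ 5 * Fintype.card F.V := by
  obtain ⟨D⟩ := hF.exists_criticalData
  exact D.bound hK2 hK4
end

section
/- If G is a ℤ/3-flow-critical graph with n vertices, n₃ of which have degree three, and G has minimum degree at least 3 and a vertex of degree at least 4, then |E(G)| ≥ n + n₃ - 1. -/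
open Finset

namespace MultiGraph

variable {G : MultiGraph}

theorem isFlow_iff_dot_deltaV (φ : G.E → ZMod 3) :
    G.IsFlow φ ↔ ∀ v, G.dot (G.deltaV v) φ = 0 := by
  simp [IsFlow, dot, deltaV, zsmul_eq_mul]

/-- A flow is orthogonal to every coboundary. -/
theorem IsFlow.sum_coboundary_mul_eq_zero {φ : G.E → ZMod 3} (hφ : G.IsFlow φ)
    (f : G.V → ZMod 3) :
    ∑ e, (f (G.head e) - f (G.tail e)) * φ e = 0 := by
  have h : ∀ e, (f (G.head e) - f (G.tail e)) * φ e
      = ∑ v, f v * ((G.sign v e : ZMod 3) * φ e) := by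
    intro e
    simp [sign, sub_mul, mul_sub, Finset.sum_sub_distrib]
  simp_rw [h]
  rw [Finset.sum_comm]
  refine Finset.sum_eq_zero fun v _ => ?_
  rw [← Finset.mul_sum]
  simpa [dot, deltaV] using congrArg (f v * ·) ((isFlow_iff_dot_deltaV φ).1 hφ v)

/-- A flow of the contraction of `e` is orthogonal to the coboundaries of functions that agree on
the endpoints of `e`. -/
theorem sum_coboundary_mul_eq_zero_of_contract {e : G.E} {ψ : (G.contract {e}).E → ZMod 3}
    (hψ : (G.contract {e}).IsFlow ψ) {φ : G.E → ZMod 3}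
    (hφ : ∀ (e' : G.E) (h : e' ∉ ({e} : Set G.E)), φ e' = ψ ⟨e', h⟩)
    (f : G.V → ZMod 3) (hf : f (G.tail e) = f (G.head e)) :
    ∑ e', (f (G.head e') - f (G.tail e')) * φ e' = 0 := by
  have hl : ∀ a b : G.V, (∃ e' ∈ ({e} : Set G.E), G.tail e' = a ∧ G.head e' = b) →
      f a = f b := by
    rintro a b ⟨e', rfl, rfl, rfl⟩
    exact hf
  rw [← hψ.sum_coboundary_mul_eq_zero (Quot.lift f hl)]
  symm
  refine Fintype.sum_of_injective (fun x : (G.contract {e}).E => x.1) Subtype.val_injective _ _ ?_ ?_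
  · intro e' he'
    have : e' = e := by
      by_contra hne
      exact he' ⟨⟨e', hne⟩, rfl⟩
    subst this
    simp [hf]
  · rintro ⟨e', he'⟩
    rw [hφ e' he']
    rfl

theorem dot_deltaV_eq_sum (v : G.V) (φ : G.E → ZMod 3) :
    G.dot (G.deltaV v) φ = ∑ e, ((Pi.single v 1 : G.V → ZMod 3) (G.head e) -
      (Pi.single v 1 : G.V → ZMod 3) (G.tail e)) * φ e := by
  simp [dot, deltaV, sign, Pi.single_apply]

theorem FlowCritical.tail_ne_head (hG : G.FlowCritical (ZMod 3)) (e : G.E) :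
    G.tail e ≠ G.head e := by
  intro hloop
  obtain ⟨ψ, hψ, hnz⟩ := hG.2.2 e
  let φ : G.E → ZMod 3 := fun e' => if h : e' ∉ ({e} : Set G.E) then ψ ⟨e', h⟩ else 1
  have hφ : ∀ (e' : G.E) (h : e' ∉ ({e} : Set G.E)), φ e' = ψ ⟨e', h⟩ := fun e' h => dif_pos h
  refine hG.2.1 ⟨φ, (isFlow_iff_dot_deltaV φ).2 fun v => ?_, fun e' => ?_⟩
  · rw [dot_deltaV_eq_sum]
    exact sum_coboundary_mul_eq_zero_of_contract hψ hφ _ (by rw [hloop])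
  · by_cases h : e' ∉ ({e} : Set G.E)
    · rw [hφ e' h]
      exact hnz _
    · simp only [φ, dif_neg h]
      decide

/-- In a flow-critical graph every edge is the zero set of some flow. -/
theorem FlowCritical.exists_flow_eq_zero_iff (hG : G.FlowCritical (ZMod 3)) (e : G.E) :
    ∃ φ : G.E → ZMod 3, G.IsFlow φ ∧ ∀ e', φ e' = 0 ↔ e' = e := by
  have hne := hG.tail_ne_head e
  obtain ⟨ψ, hψ, hnz⟩ := hG.2.2 e
  let φ₀ : G.E → ZMod 3 := fun e' => if h : e' ∉ ({e} : Set G.E) then ψ ⟨e', h⟩ else 0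
  let φ : G.E → ZMod 3 := φ₀ + Pi.single e (-G.dot (G.deltaV (G.head e)) φ₀)
  have hφ : ∀ (e' : G.E) (h : e' ∉ ({e} : Set G.E)), φ e' = ψ ⟨e', h⟩ := by
    intro e' h
    have h' : e' ≠ e := h
    simp [φ, φ₀, h']
  have hφ_ne : ∀ e', e' ≠ e → φ e' ≠ 0 := by
    intro e' h
    rw [hφ e' h]
    exact hnz _
  have hhead : G.dot (G.deltaV (G.head e)) φ = 0 := by
    have : G.deltaV (G.head e) e = 1 := by simp [deltaV, sign, hne]
    simp only [dot, φ, Pi.add_apply, mul_add, Finset.sum_add_distrib]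
    simp [Pi.single_apply, this]
  have hflow : G.IsFlow φ := by
    refine (isFlow_iff_dot_deltaV φ).2 fun v => ?_
    by_cases hv : v = G.head e
    · rw [hv, hhead]
    by_cases hv' : v = G.tail e
    · have h := sum_coboundary_mul_eq_zero_of_contract hψ hφ
        (Pi.single (G.tail e) 1 + Pi.single (G.head e) 1) (by simp [hne, hne.symm])
      have h2 := hhead
      rw [dot_deltaV_eq_sum] at h2 ⊢
      rw [hv', ← h]
      simp only [Pi.add_apply]
      rw [← add_zero (∑ _, _), ← h2, ← Finset.sum_add_distrib]
      exact Finset.sum_congr rfl fun _ _ => by ring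
    · rw [dot_deltaV_eq_sum]
      exact sum_coboundary_mul_eq_zero_of_contract hψ hφ _ (by simp [Ne.symm hv, Ne.symm hv'])
  refine ⟨φ, hflow, fun e' => ⟨fun h => by_contra fun h' => hφ_ne e' h' h, ?_⟩⟩
  rintro rfl
  by_contra h0
  refine hG.2.1 ⟨φ, hflow, fun e'' => ?_⟩
  by_cases h : e'' = e'
  · rwa [h]
  · exact hφ_ne e'' h

theorem deltaV_ne_zero_iff (hloop : ∀ e, G.tail e ≠ G.head e) (v : G.V) (e : G.E) :
    G.deltaV v e ≠ 0 ↔ G.Incident v e := by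
  have := hloop e
  unfold deltaV sign Incident
  by_cases h1 : G.head e = v <;> by_cases h2 : G.tail e = v <;> simp_all

theorem exists_three_incident (hloop : ∀ e, G.tail e ≠ G.head e) {v : G.V}
    (hv : G.degree v = 3) :
    ∃ e₁ e₂ e₃ : G.E, e₁ ≠ e₂ ∧ e₁ ≠ e₃ ∧ e₂ ≠ e₃ ∧
      ∀ e, G.Incident v e ↔ e = e₁ ∨ e = e₂ ∨ e = e₃ := by
  have hcard : ((univ.filter fun e : G.E => G.tail e = v) ∪
      (univ.filter fun e : G.E => G.head e = v)).card = 3 := by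
    rw [Finset.card_union_of_disjoint, ← hv, degree]
    rw [Finset.disjoint_filter]
    rintro e - h1 h2
    exact hloop e (h1.trans h2.symm)
  obtain ⟨e₁, e₂, e₃, h12, h13, h23, heq⟩ := Finset.card_eq_three.1 hcard
  refine ⟨e₁, e₂, e₃, h12, h13, h23, fun e => ?_⟩
  simpa [Incident] using Finset.ext_iff.1 heq e

theorem dot_deltaPair (v : G.V) {e₁ e₂ : G.E} (h : e₁ ≠ e₂) (φ : G.E → ZMod 3) :
    G.dot (G.deltaPair v e₁ e₂) φ = G.deltaV v e₁ * φ e₁ - G.deltaV v e₂ * φ e₂ := by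
  have : ∀ e, G.deltaPair v e₁ e₂ e * φ e =
      (if e = e₁ then G.deltaV v e₁ * φ e₁ else 0) -
        (if e = e₂ then G.deltaV v e₂ * φ e₂ else 0) := by
    intro e
    unfold deltaPair deltaV
    by_cases h1 : e = e₁
    · subst h1; simp [h]
    · by_cases h2 : e = e₂
      · subst h2; simp [h1]
      · simp [h1, h2]
  simp [dot, this, Finset.sum_sub_distrib]

/-- At a vertex of degree three some vector `δ_{v,e₁,e₂}` detects, for each flow vanishing on
exactly one edge, whether this edge is incident with `v`. -/
theorem exists_dot_ne_zero_iff_incident (hloop : ∀ e, G.tail e ≠ G.head e) {v : G.V}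
    (hv : G.degree v = 3) :
    ∃ γ : G.E → ZMod 3, ∀ (e : G.E) (φ : G.E → ZMod 3), G.IsFlow φ →
      (∀ e', φ e' = 0 ↔ e' = e) → (G.dot γ φ ≠ 0 ↔ G.Incident v e) := by
  obtain ⟨e₁, e₂, e₃, h12, h13, h23, hinc⟩ := exists_three_incident hloop hv
  refine ⟨G.deltaPair v e₁ e₂, fun e φ hφ hzero => ?_⟩
  have hδ : ∀ e', G.deltaV v e' ≠ 0 ↔ e' = e₁ ∨ e' = e₂ ∨ e' = e₃ := fun e' =>
    (deltaV_ne_zero_iff hloop v e').trans (hinc e')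
  have hsum : G.deltaV v e₁ * φ e₁ + G.deltaV v e₂ * φ e₂ + G.deltaV v e₃ * φ e₃ = 0 := by
    rw [← (isFlow_iff_dot_deltaV φ).1 hφ v, dot,
      ← Finset.sum_subset (Finset.subset_univ {e₁, e₂, e₃})]
    · rw [Finset.sum_insert (by simp [h12, h13]), Finset.sum_pair h23, add_assoc]
    · intro e' _ he'
      have : G.deltaV v e' = 0 := by
        by_contra h
        exact he' (by simpa using (hδ e').1 h)
      simp [this]
  have hu : ∀ e', (e' = e₁ ∨ e' = e₂ ∨ e' = e₃) →
      (G.deltaV v e' * φ e' = 0 ↔ e' = e) := by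
    intro e' he'
    rw [mul_eq_zero, hzero e']
    simp [(hδ e').2 he']
  have hu₁ := hu e₁ (by simp)
  have hu₂ := hu e₂ (by simp)
  have hu₃ := hu e₃ (by simp)
  rw [dot_deltaPair v h12, hinc]
  generalize G.deltaV v e₁ * φ e₁ = a at *
  generalize G.deltaV v e₂ * φ e₂ = b at *
  generalize G.deltaV v e₃ * φ e₃ = c at *
  have hne_of : ∀ a b c : ZMod 3, a + b + c = 0 → ((a = 0 ∧ b ≠ 0) ∨ (a ≠ 0 ∧ b = 0) ∨
      (a ≠ 0 ∧ b ≠ 0 ∧ c = 0)) → a - b ≠ 0 := by decide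
  have heq_of : ∀ a b c : ZMod 3, a + b + c = 0 → a ≠ 0 → b ≠ 0 → c ≠ 0 → a - b = 0 := by decide
  constructor
  · intro h
    by_contra hcon
    push Not at hcon
    exact h (heq_of a b c hsum (fun h => hcon.1 (hu₁.1 h).symm)
      (fun h => hcon.2.1 (hu₂.1 h).symm) (fun h => hcon.2.2 (hu₃.1 h).symm))
  · intro h
    refine hne_of a b c hsum ?_
    rcases h with rfl | rfl | rfl
    · exact Or.inl ⟨hu₁.2 rfl, fun h => h12 (hu₂.1 h).symm⟩
    · exact Or.inr (Or.inl ⟨fun h => h12 (hu₁.1 h), hu₂.2 rfl⟩)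
    · exact Or.inr (Or.inr ⟨fun h => h13 (hu₁.1 h), fun h => h23 (hu₂.1 h), hu₃.2 rfl⟩)

/-- In a connected graph a property of vertices that passes along edges in both directions holds
everywhere as soon as it holds somewhere. -/
theorem Connected.forall_of_edge (hG : G.Connected) {p : G.V → Prop} {w : G.V} (hw : p w)
    (hp : ∀ e, p (G.tail e) ↔ p (G.head e)) (v : G.V) : p v := by
  induction hG.2 w v with
  | refl => exact hw
  | tail _ hadj ih =>
    obtain ⟨e, ⟨rfl, rfl⟩ | ⟨rfl, rfl⟩⟩ := hadj
    · exact (hp e).1 ih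
    · exact (hp e).2 ih

/-- The only relation between the vectors `δ_v` and `γ_v`, for `v` of degree three, with vanishing
coefficient of `δ_w` is the trivial one, provided that `w` is not of degree three. -/
theorem FlowCritical.eq_zero_of_sum_eq_zero (hG : G.FlowCritical (ZMod 3)) {w : G.V}
    (hw : G.degree w ≠ 3) {γ : G.V → G.E → ZMod 3}
    (hγ : ∀ v, G.degree v = 3 → ∀ (e : G.E) (φ : G.E → ZMod 3), G.IsFlow φ →
      (∀ e', φ e' = 0 ↔ e' = e) → (G.dot (γ v) φ ≠ 0 ↔ G.Incident v e))
    {a b : G.V → ZMod 3} (ha : a w = 0) (hb : ∀ v, G.degree v ≠ 3 → b v = 0)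
    (hsum : ∑ v, a v • G.deltaV v + ∑ v, b v • γ v = 0) : a = 0 ∧ b = 0 := by
  have hb0 : b = 0 := by
    refine funext (hG.1.forall_of_edge (p := fun v => b v = 0) (hb w hw) fun e => ?_)
    obtain ⟨φ, hφ, hzero⟩ := hG.exists_flow_eq_zero_iff e
    have hlin : ∑ v, a v * G.dot (G.deltaV v) φ + ∑ v, b v * G.dot (γ v) φ = 0 := by
      have h := congrArg (fun c => G.dot c φ) hsum
      simp only [dot, Pi.add_apply, Finset.sum_apply, Pi.smul_apply, smul_eq_mul, add_mul,
        Finset.sum_add_distrib, Finset.sum_mul, Pi.zero_apply, zero_mul,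
        Finset.sum_const_zero] at h
      rw [Finset.sum_comm, Finset.sum_comm (f := fun e v => b v * γ v e * φ e)] at h
      simpa only [dot, Finset.mul_sum, mul_assoc] using h
    simp only [(isFlow_iff_dot_deltaV φ).1 hφ, mul_zero, Finset.sum_const_zero, zero_add] at hlin
    have hedge : b (G.tail e) * G.dot (γ (G.tail e)) φ +
        b (G.head e) * G.dot (γ (G.head e)) φ = 0 := by
      rw [← hlin, ← Finset.sum_subset (Finset.subset_univ {G.tail e, G.head e}),
        Finset.sum_pair (hG.tail_ne_head e)]
      intro v _ hv
      by_cases h3 : G.degree v = 3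
      · have : G.dot (γ v) φ = 0 := by
          by_contra h
          rcases (hγ v h3 e φ hφ hzero).1 h with h | h <;> simp [← h] at hv
        simp [this]
      · simp [hb v h3]
    have hiff : ∀ v, G.Incident v e → (b v * G.dot (γ v) φ = 0 ↔ b v = 0) := by
      intro v hv
      by_cases h3 : G.degree v = 3
      · simp [(hγ v h3 e φ hφ hzero).2 hv]
      · simp [hb v h3]
    rw [← hiff _ (Or.inl rfl), ← hiff _ (Or.inr rfl)]
    constructor <;> intro h <;> simpa [h] using hedge
  refine ⟨funext (hG.1.forall_of_edge (p := fun v => a v = 0) ha fun e => ?_), hb0⟩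
  have h := congrFun hsum e
  simp only [hb0, Pi.zero_apply, zero_smul, Finset.sum_const_zero, add_zero, Finset.sum_apply,
    Pi.smul_apply, smul_eq_mul, deltaV, sign] at h
  simp only [Int.cast_sub, Int.cast_ite, Int.cast_one, Int.cast_zero, mul_sub, mul_ite, mul_one,
    mul_zero, Finset.sum_sub_distrib, Finset.sum_ite_eq, Finset.mem_univ, if_true] at h
  rw [sub_eq_zero.1 h]

end MultiGraph

open MultiGraph in
/-- If `G` is `ℤ/3`-flow-critical with `n` vertices, `n₃` of degree three,
minimum degree at least `3` and a vertex of degree at least `4`, then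
`|E(G)| ≥ n + n₃ - 1`. -/
theorem edges_ge_lower (G : MultiGraph) (hG : G.FlowCritical (ZMod 3))
    (hmin : ∀ v : G.V, 3 ≤ G.degree v) (hmax : ∃ w : G.V, 4 ≤ G.degree w) :
    Fintype.card G.E + 1 ≥
      Fintype.card G.V + (univ.filter fun v : G.V => G.degree v = 3).card := by
  obtain ⟨w, hw⟩ := hmax
  have hγ : ∀ v, ∃ γ : G.E → ZMod 3, G.degree v = 3 → ∀ (e : G.E) (φ : G.E → ZMod 3),
      G.IsFlow φ → (∀ e', φ e' = 0 ↔ e' = e) → (G.dot γ φ ≠ 0 ↔ G.Incident v e) := by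
    intro v
    by_cases h3 : G.degree v = 3
    · obtain ⟨γ, hγ⟩ := exists_dot_ne_zero_iff_incident hG.tail_ne_head h3
      exact ⟨γ, fun _ => hγ⟩
    · exact ⟨0, fun h => absurd h h3⟩
  choose γ hγ using hγ
  have hli : LinearIndependent (ZMod 3)
      (Sum.elim (fun v : {v : G.V // v ≠ w} => G.deltaV v)
        (fun v : {v : G.V // G.degree v = 3} => γ v)) := by
    rw [Fintype.linearIndependent_iff]
    intro g hg
    let a : G.V → ZMod 3 := fun v => if h : v ≠ w then g (Sum.inl ⟨v, h⟩) else 0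
    let b : G.V → ZMod 3 := fun v => if h : G.degree v = 3 then g (Sum.inr ⟨v, h⟩) else 0
    have hab : a = 0 ∧ b = 0 := by
      refine hG.eq_zero_of_sum_eq_zero (w := w) (by omega) hγ (by simp [a])
        (fun v hv => dif_neg hv) ?_
      rw [← hg, Fintype.sum_sum_type]
      congr 1 <;> symm
      · refine Fintype.sum_of_injective Subtype.val Subtype.val_injective _ _ ?_ ?_
        · intro v hv
          have : v = w := by simpa using hv
          simp [a, this]
        · rintro ⟨v, hv⟩
          simp [a, hv]
      · refine Fintype.sum_of_injective Subtype.val Subtype.val_injective _ _ ?_ ?_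
        · intro v hv
          have : G.degree v ≠ 3 := by simpa using hv
          simp [b, this]
        · rintro ⟨v, hv⟩
          simp [b, hv]
    rintro (⟨v, hv⟩ | ⟨v, hv⟩)
    · simpa [a, hv] using congrFun hab.1 v
    · simpa [b, hv] using congrFun hab.2 v
  have hcard := hli.fintype_card_le_finrank
  rw [Module.finrank_fintype_fun_eq_card, Fintype.card_sum, Fintype.card_subtype_compl,
    Fintype.card_subtype_eq, Fintype.card_subtype] at hcard
  omega
end
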